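/- Let d ≥ 1 and 1 ≤ k ≤ d be integers, let w ∈ ℝ, and let F be a finite family of convex sets in ℝ^d. Define f(x,y) = 2^(d−k) · Σ_{V ⊆ {1,…,d}, |V| = k} ∏_{i ∈ V} (y_i − x_i), which is the k-dimensional volume of the k-skeleton of the box bx(x,y). If the intersection of every subfamily of F with at most 2d members contains an axis-parallel box bx(x,y) with f(x,y) ≥ w, then the intersection of all members of F contains an axis-parallel box bx(x,y) with f(x,y) ≥ w. -/

import Mathlib

/-- The `k`-dimensional volume of the `k`-skeleton of the axis-parallel box `bx(x,y)`:
`f(x,y) = 2^(d-k) · Σ_{V ⊆ [d], |V| = k} ∏_{i ∈ V} (yᵢ - xᵢ)`. -/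
noncomputable def skeletonVolume (d k : ℕ) (x y : Fin d → ℝ) : ℝ :=
  2 ^ (d - k) *
    ∑ V ∈ Finset.powersetCard k (Finset.univ : Finset (Fin d)), ∏ i ∈ V, (y i - x i)

/-- The elementary symmetric function of degree `k` in the variables `x i`, `i ∈ s`. -/
def elemSymm {ι : Type*} (s : Finset ι) (k : ℕ) (x : ι → ℝ) : ℝ :=
  ∑ V ∈ s.powersetCard k, ∏ i ∈ V, x i

section ElemSymm

variable {ι : Type*} {s : Finset ι} {k : ℕ} {x y : ι → ℝ}

@[simp]
theorem elemSymm_zero (s : Finset ι) (x : ι → ℝ) : elemSymm s 0 x = 1 := by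
  simp [elemSymm]

theorem elemSymm_smul (s : Finset ι) (k : ℕ) (t : ℝ) (x : ι → ℝ) :
    elemSymm s k (t • x) = t ^ k * elemSymm s k x := by
  rw [elemSymm, elemSymm, Finset.mul_sum]
  refine Finset.sum_congr rfl fun V hV ↦ ?_
  simp [Finset.prod_mul_distrib, (Finset.mem_powersetCard.1 hV).2]

theorem elemSymm_pos (hk : k ≤ s.card) (hx : ∀ i, 0 < x i) : 0 < elemSymm s k x :=
  Finset.sum_pos (fun _ _ ↦ Finset.prod_pos fun i _ ↦ hx i) (Finset.powersetCard_nonempty.2 hk)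

theorem elemSymm_nonneg (hx : ∀ i, 0 ≤ x i) : 0 ≤ elemSymm s k x :=
  Finset.sum_nonneg fun _ _ ↦ Finset.prod_nonneg fun i _ ↦ hx i

theorem elemSymm_mono (hx : ∀ i, 0 ≤ x i) (hxy : x ≤ y) : elemSymm s k x ≤ elemSymm s k y :=
  Finset.sum_le_sum fun _ _ ↦ Finset.prod_le_prod (fun i _ ↦ hx i) fun i _ ↦ hxy i

theorem continuous_elemSymm (s : Finset ι) (k : ℕ) : Continuous (elemSymm s k) := by
  unfold elemSymm
  fun_prop

theorem elemSymm_insert [DecidableEq ι] {a : ι} (ha : a ∉ s) (k : ℕ) (x : ι → ℝ) :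
    elemSymm (insert a s) (k + 1) x = x a * elemSymm s k x + elemSymm s (k + 1) x := by
  have hmem : ∀ n, ∀ V ∈ s.powersetCard n, a ∉ V := fun n V hV h ↦
    ha ((Finset.mem_powersetCard.1 hV).1 h)
  rw [elemSymm, Finset.powersetCard_succ_insert ha, Finset.sum_union, add_comm, Finset.sum_image]
  · congr 1
    rw [elemSymm, Finset.mul_sum]
    exact Finset.sum_congr rfl fun V hV ↦ Finset.prod_insert (hmem k V hV)
  · intro V hV W hW h
    rw [← Finset.erase_insert (hmem k V hV), ← Finset.erase_insert (hmem k W hW), h]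
  · rw [Finset.disjoint_left]
    intro V hV hV'
    obtain ⟨W, -, rfl⟩ := Finset.mem_image.1 hV'
    exact hmem _ _ hV (Finset.mem_insert_self a W)

theorem elemSymm_eq_erase [DecidableEq ι] {a : ι} (ha : a ∈ s) (k : ℕ) (x : ι → ℝ) :
    elemSymm s (k + 1) x =
      x a * elemSymm (s.erase a) k x + elemSymm (s.erase a) (k + 1) x := by
  rw [← elemSymm_insert (Finset.notMem_erase a s), Finset.insert_erase ha]

theorem sum_mul_elemSymm_erase [DecidableEq ι] (s : Finset ι) (k : ℕ) (x : ι → ℝ) :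
    ∑ i ∈ s, x i * elemSymm (s.erase i) k x = (k + 1) * elemSymm s (k + 1) x := by
  have hterm : ∀ i ∈ s, x i * elemSymm (s.erase i) k x =
      ∑ V ∈ s.powersetCard (k + 1), if i ∈ V then ∏ j ∈ V, x j else 0 := by
    intro i hi
    rw [eq_sub_of_add_eq (elemSymm_eq_erase hi k x).symm, sub_eq_iff_eq_add, elemSymm,
      ← Finset.sum_filter, ← Finset.sum_filter_add_sum_filter_not _ (fun V ↦ i ∈ V), elemSymm]
    congr 2
    ext V
    simp only [Finset.mem_filter, Finset.mem_powersetCard, Finset.subset_erase]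
    tauto
  rw [Finset.sum_congr rfl hterm, Finset.sum_comm, elemSymm, Finset.mul_sum]
  refine Finset.sum_congr rfl fun V hV ↦ ?_
  obtain ⟨hVs, hVk⟩ := Finset.mem_powersetCard.1 hV
  rw [← Finset.sum_filter, Finset.filter_mem_eq_inter, Finset.inter_eq_right.2 hVs,
    Finset.sum_const, hVk, nsmul_eq_mul]
  push_cast
  rfl

/-- Superadditivity of the parallel sum `a b / (a + b)`. -/
theorem parallel_sum_superadditive {a b c d : ℝ} (ha : 0 < a) (hc : 0 < c) (hb : 0 ≤ b)
    (hd : 0 ≤ d) :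
    a * b / (a + b) + c * d / (c + d) ≤ (a + c) * (b + d) / (a + c + (b + d)) := by
  have key : (a + c) * (b + d) / (a + c + (b + d)) - (a * b / (a + b) + c * d / (c + d)) =
      (a * d - b * c) ^ 2 / ((a + c + (b + d)) * (a + b) * (c + d)) := by
    have h1 : a + b ≠ 0 := by positivity
    have h2 : c + d ≠ 0 := by positivity
    have h3 : a + c + (b + d) ≠ 0 := by positivity
    field_simp
    ring
  have : 0 ≤ (a * d - b * c) ^ 2 / ((a + c + (b + d)) * (a + b) * (c + d)) := by positivity
  linarith

theorem parallel_sum_mono {a b c : ℝ} (ha : 0 < a) (hb : 0 ≤ b) (hbc : b ≤ c) :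
    a * b / (a + b) ≤ a * c / (a + c) := by
  have hc := hb.trans hbc
  rw [div_le_div_iff₀ (by positivity) (by positivity)]
  nlinarith [mul_le_mul_of_nonneg_left hbc (sq_nonneg a)]

/-- The ratio of consecutive elementary symmetric functions is a mean of parallel sums. -/
theorem elemSymm_ratio_eq_sum [DecidableEq ι] (hk : k + 1 ≤ s.card) (hx : ∀ i, 0 < x i) :
    elemSymm s (k + 2) x / elemSymm s (k + 1) x =
      (∑ i ∈ s, x i * (elemSymm (s.erase i) (k + 1) x / elemSymm (s.erase i) k x) /
        (x i + elemSymm (s.erase i) (k + 1) x / elemSymm (s.erase i) k x)) / (k + 2) := by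
  have hpos := elemSymm_pos hk hx
  have hterm : ∀ i ∈ s, x i * (elemSymm (s.erase i) (k + 1) x / elemSymm (s.erase i) k x) /
      (x i + elemSymm (s.erase i) (k + 1) x / elemSymm (s.erase i) k x) =
      x i * elemSymm (s.erase i) (k + 1) x / elemSymm s (k + 1) x := by
    intro i hi
    have hcard : k ≤ (s.erase i).card := by rw [Finset.card_erase_of_mem hi]; omega
    have hpos' := elemSymm_pos hcard hx
    have hrec := elemSymm_eq_erase hi k x
    rw [hrec] at hpos ⊢
    field_simp
  rw [Finset.sum_congr rfl hterm, ← Finset.sum_div, sum_mul_elemSymm_erase]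
  push_cast
  field_simp
  ring

/-- The Marcus–Lopes inequality. -/
theorem elemSymm_ratio_superadditive (hk : k ≤ s.card) (hx : ∀ i, 0 < x i) (hy : ∀ i, 0 < y i) :
    elemSymm s (k + 1) x / elemSymm s k x + elemSymm s (k + 1) y / elemSymm s k y ≤
      elemSymm s (k + 1) (x + y) / elemSymm s k (x + y) := by
  classical
  induction k generalizing s with
  | zero => simp [elemSymm, Finset.powersetCard_one, Finset.sum_add_distrib]
  | succ k ih =>
    have hxy : ∀ i, 0 < (x + y) i := fun i ↦ add_pos (hx i) (hy i)
    rw [elemSymm_ratio_eq_sum hk hx, elemSymm_ratio_eq_sum hk hy, elemSymm_ratio_eq_sum hk hxy,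
      ← add_div, ← Finset.sum_add_distrib]
    gcongr with i hi
    have hcard : k ≤ (s.erase i).card := by rw [Finset.card_erase_of_mem hi]; omega
    have hnn : ∀ {z : ι → ℝ}, (∀ i, 0 < z i) →
        0 ≤ elemSymm (s.erase i) (k + 1) z / elemSymm (s.erase i) k z := fun hz ↦
      div_nonneg (elemSymm_nonneg fun i ↦ (hz i).le) (elemSymm_nonneg fun i ↦ (hz i).le)
    exact (parallel_sum_superadditive (hx i) (hy i) (hnn hx) (hnn hy)).trans
      (parallel_sum_mono (hxy i) (add_nonneg (hnn hx) (hnn hy)) (ih hcard))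

theorem elemSymm_log_concave {a b : ℝ} (ha : 0 < a) (hb : 0 < b) (hab : a + b = 1)
    (hk : k ≤ s.card) (hx : ∀ i, 0 < x i) (hy : ∀ i, 0 < y i) :
    elemSymm s k x ^ a * elemSymm s k y ^ b ≤ elemSymm s k (a • x + b • y) := by
  induction k with
  | zero => simp
  | succ k ih =>
    have hk' : k ≤ s.card := by omega
    have hax : ∀ i, 0 < (a • x) i := fun i ↦ mul_pos ha (hx i)
    have hby : ∀ i, 0 < (b • y) i := fun i ↦ mul_pos hb (hy i)
    have hz : ∀ i, 0 < (a • x + b • y) i := fun i ↦ add_pos (hax i) (hby i)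
    have px := elemSymm_pos hk' hx
    have py := elemSymm_pos hk' hy
    have pz := elemSymm_pos hk' hz
    have px' := elemSymm_pos hk hx
    have py' := elemSymm_pos hk hy
    have hscale : ∀ {t : ℝ} {z : ι → ℝ}, 0 < t → 0 < elemSymm s k z →
        elemSymm s (k + 1) (t • z) / elemSymm s k (t • z) =
          t * (elemSymm s (k + 1) z / elemSymm s k z) := by
      intro t z ht hz
      rw [elemSymm_smul, elemSymm_smul]
      field_simp
      ring
    have hratio := elemSymm_ratio_superadditive hk' hax hby
    rw [hscale ha px, hscale hb py] at hratio
    have hmean := (Real.geom_mean_le_arith_mean2_weighted ha.le hb.le (div_pos px' px).le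
      (div_pos py' py).le hab).trans hratio
    calc elemSymm s (k + 1) x ^ a * elemSymm s (k + 1) y ^ b
        = ((elemSymm s (k + 1) x / elemSymm s k x) ^ a *
            (elemSymm s (k + 1) y / elemSymm s k y) ^ b) *
          (elemSymm s k x ^ a * elemSymm s k y ^ b) := by
          rw [mul_mul_mul_comm, ← Real.mul_rpow (div_pos px' px).le px.le,
            ← Real.mul_rpow (div_pos py' py).le py.le, div_mul_cancel₀ _ px.ne',
            div_mul_cancel₀ _ py.ne']
      _ ≤ elemSymm s (k + 1) (a • x + b • y) / elemSymm s k (a • x + b • y) *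
          elemSymm s k (a • x + b • y) := by
          have hrhs := elemSymm_pos hk hz
          have := ih hk'
          gcongr
      _ = elemSymm s (k + 1) (a • x + b • y) := div_mul_cancel₀ _ pz.ne'

theorem elemSymm_quasiconcaveOn (hk : k ≤ s.card) :
    QuasiconcaveOn ℝ {x : ι → ℝ | 0 ≤ x} (elemSymm s k) := by
  rw [quasiconcaveOn_iff_min_le]
  refine ⟨convex_Ici 0, fun x hx y hy a b ha hb hab ↦ ?_⟩
  rcases ha.eq_or_lt with rfl | ha
  · simp_all
  rcases hb.eq_or_lt with rfl | hb
  · simp_all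
  have hpert : ∀ ε : ℝ, 0 < ε → min (elemSymm s k x) (elemSymm s k y) ≤
      elemSymm s k (a • x + b • y + fun _ ↦ ε) := by
    intro ε hε
    have hpos : ∀ {z : ι → ℝ}, 0 ≤ z → ∀ i, 0 < (z + fun _ ↦ ε : ι → ℝ) i := fun hz i ↦
      add_pos_of_nonneg_of_pos (hz i) hε
    have hle : ∀ {z : ι → ℝ}, 0 ≤ z → elemSymm s k z ≤ elemSymm s k (z + fun _ ↦ ε) := fun hz ↦
      elemSymm_mono hz (le_add_of_nonneg_right fun _ ↦ hε.le)
    set m := min (elemSymm s k (x + fun _ ↦ ε)) (elemSymm s k (y + fun _ ↦ ε))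
    have hm0 : 0 < m := lt_min (elemSymm_pos hk (hpos hx)) (elemSymm_pos hk (hpos hy))
    calc min (elemSymm s k x) (elemSymm s k y) ≤ m := min_le_min (hle hx) (hle hy)
      _ = m ^ a * m ^ b := by rw [← Real.rpow_add hm0, hab, Real.rpow_one]
      _ ≤ elemSymm s k (x + fun _ ↦ ε) ^ a * elemSymm s k (y + fun _ ↦ ε) ^ b := by
          have h1 : m ≤ elemSymm s k (x + fun _ ↦ ε) := min_le_left _ _
          have h2 : m ≤ elemSymm s k (y + fun _ ↦ ε) := min_le_right _ _
          have h0 := hm0.le.trans h1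
          gcongr
      _ ≤ elemSymm s k (a • (x + fun _ ↦ ε) + b • (y + fun _ ↦ ε)) :=
          elemSymm_log_concave ha hb hab hk (hpos hx) (hpos hy)
      _ = elemSymm s k (a • x + b • y + fun _ ↦ ε) := by
          congr 1
          ext i
          simp only [Pi.add_apply, Pi.smul_apply, smul_eq_mul]
          linear_combination ε * hab
  have hcont : Continuous fun ε : ℝ ↦ elemSymm s k (a • x + b • y + fun _ ↦ ε) :=
    (continuous_elemSymm s k).comp (by fun_prop)
  have hlim := (hcont.tendsto 0).mono_left (nhdsWithin_le_nhds (s := Set.Ioi 0))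
  have hzero : (a • x + b • y + fun _ ↦ (0 : ℝ)) = a • x + b • y := add_zero _
  rw [hzero] at hlim
  exact ge_of_tendsto hlim (eventually_nhdsWithin_of_forall hpert)

end ElemSymm

section Boxes

variable {ι : Type*}

theorem convex_boxes_subset {A : Set (ι → ℝ)} (hA : Convex ℝ A) :
    Convex ℝ {p : (ι → ℝ) × (ι → ℝ) | p.1 ≤ p.2 ∧ Set.Icc p.1 p.2 ⊆ A} := by
  rintro ⟨x, y⟩ ⟨hxy, hxyA⟩ ⟨x', y'⟩ ⟨hxy', hxyA'⟩ a b ha hb hab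
  simp only at hxy hxyA hxy' hxyA'
  refine ⟨add_le_add (smul_le_smul_of_nonneg_left hxy ha)
    (smul_le_smul_of_nonneg_left hxy' hb), fun z hz ↦ ?_⟩
  have hcoord : ∀ i, ∃ u v : ℝ, u ∈ Set.Icc (x i) (y i) ∧ v ∈ Set.Icc (x' i) (y' i) ∧
      a * u + b * v = z i := by
    intro i
    have hle : a * x i + b * x' i ≤ a * y i + b * y' i := by
      have := hxy i
      have := hxy' i
      gcongr
    have hzi : z i ∈ segment ℝ (a * x i + b * x' i) (a * y i + b * y' i) := by
      rw [segment_eq_Icc hle]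
      exact ⟨hz.1 i, hz.2 i⟩
    obtain ⟨p, q, hp, hq, hpq, h⟩ := hzi
    refine ⟨p * x i + q * y i, p * x' i + q * y' i, ?_, ?_, ?_⟩
    · rw [← segment_eq_Icc (hxy i)]
      exact ⟨p, q, hp, hq, hpq, rfl⟩
    · rw [← segment_eq_Icc (hxy' i)]
      exact ⟨p, q, hp, hq, hpq, rfl⟩
    · rw [← h]
      simp only [smul_eq_mul]
      ring
  choose u v hu hv huv using hcoord
  have hz' : a • u + b • v = z := funext huv
  rw [← hz']
  exact hA (hxyA ⟨fun i ↦ (hu i).1, fun i ↦ (hu i).2⟩)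
    (hxyA' ⟨fun i ↦ (hv i).1, fun i ↦ (hv i).2⟩) ha hb hab

theorem convex_boxes_skeletonVolume_ge {d k : ℕ} (hkd : k ≤ d) (w : ℝ) :
    Convex ℝ {p : (Fin d → ℝ) × (Fin d → ℝ) | p.1 ≤ p.2 ∧ w ≤ skeletonVolume d k p.1 p.2} := by
  have hq := elemSymm_quasiconcaveOn (s := (Finset.univ : Finset (Fin d))) (k := k) (by simpa)
  have hpre := (hq (w / 2 ^ (d - k))).linear_preimage
    (LinearMap.snd ℝ (Fin d → ℝ) (Fin d → ℝ) - LinearMap.fst ℝ (Fin d → ℝ) (Fin d → ℝ))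
  refine (congrArg (Convex ℝ) (Set.ext fun p ↦ ?_)).mp hpre
  simp [skeletonVolume, elemSymm, div_le_iff₀']

end Boxes

/-- Helly-type theorem for the `k`-dimensional volume of the `k`-skeleton of a box:
if every subfamily of at most `2d` members of a finite family of convex sets in `ℝ^d`
has, in its intersection, an axis-parallel box whose `k`-skeleton has `k`-volume at least
`w`, then so does the intersection of the whole family. -/
theorem box_skeleton_helly (d k : ℕ) (hd : 1 ≤ d) (hk1 : 1 ≤ k) (hkd : k ≤ d) (w : ℝ)
    (F : Finset (Set (Fin d → ℝ))) (hconv : ∀ A ∈ F, Convex ℝ A)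
    (hloc : ∀ G ⊆ F, G.card ≤ 2 * d →
      ∃ x y : Fin d → ℝ, x ≤ y ∧ (∀ A ∈ G, Set.Icc x y ⊆ A) ∧ w ≤ skeletonVolume d k x y) :
    ∃ x y : Fin d → ℝ, x ≤ y ∧ (∀ A ∈ F, Set.Icc x y ⊆ A) ∧ w ≤ skeletonVolume d k x y := by
  classical
  obtain ⟨c, hc⟩ : (⋂₀ (F : Set (Set (Fin d → ℝ)))).Nonempty := by
    refine Convex.helly_theorem_set' (𝕜 := ℝ) hconv fun G hGF hG ↦ ?_
    rw [Module.finrank_fin_fun] at hG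
    obtain ⟨x, y, hxy, hxyG, -⟩ := hloc G hGF (by omega)
    exact ⟨x, fun A hA ↦ hxyG A hA ⟨le_rfl, hxy⟩⟩
  -- `none` stands for the volume constraint, `some A` for containment in `A`
  let C : Option (Set (Fin d → ℝ)) → Set ((Fin d → ℝ) × (Fin d → ℝ)) := fun o ↦
    o.elim {p | p.1 ≤ p.2 ∧ w ≤ skeletonVolume d k p.1 p.2}
      fun A ↦ {p | p.1 ≤ p.2 ∧ Set.Icc p.1 p.2 ⊆ A}
  have hC : (⋂ o ∈ Finset.insertNone F, C o).Nonempty := by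
    refine Convex.helly_theorem' (𝕜 := ℝ) ?_ fun I hIF hI ↦ ?_
    · rintro (_ | A) hA
      · exact convex_boxes_skeletonVolume_ge hkd w
      · exact convex_boxes_subset (hconv A (Finset.some_mem_insertNone.1 hA))
    · rw [Module.finrank_prod, Module.finrank_fin_fun] at hI
      have hIF' : Finset.eraseNone I ⊆ F := fun A hA ↦
        Finset.some_mem_insertNone.1 (hIF (Finset.mem_eraseNone.1 hA))
      by_cases hnone : none ∈ I
      · have hcard := Finset.card_eraseNone_of_mem hnone
        obtain ⟨x, y, hxy, hxyG, hw⟩ := hloc (Finset.eraseNone I) hIF' (by omega)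
        refine ⟨(x, y), Set.mem_iInter₂.2 ?_⟩
        rintro (_ | A) hA
        · exact ⟨hxy, hw⟩
        · exact ⟨hxy, hxyG A (Finset.mem_eraseNone.2 hA)⟩
      · refine ⟨(c, c), Set.mem_iInter₂.2 ?_⟩
        rintro (_ | A) hA
        · exact absurd hA hnone
        · refine ⟨le_rfl, ?_⟩
          rw [Set.Icc_self, Set.singleton_subset_iff]
          exact hc A (hIF' (Finset.mem_eraseNone.2 hA))
  obtain ⟨⟨x, y⟩, hp⟩ := hC
  rw [Set.mem_iInter₂] at hp
  obtain ⟨hxy, hw⟩ := hp none Finset.none_mem_insertNone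
  exact ⟨x, y, hxy, fun A hA ↦ (hp (some A) (Finset.some_mem_insertNone.2 hA)).2, hw⟩
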